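/- Let 2 ≤ n ≤ N, θ_n ∈ [0,1/2], and α ∈ (0,1). Then for every 1 ≤ k ≤ n−1 one has J_{n−k}^{(α)} ≥ I_{n−k}^{(α)}; more precisely, J_{n−k}^{(α)} − I_{n−k}^{(α)} = (α(1+α)/(Γ(1−α) τ_k)) ∫_{t_{k−1}}^{t_k} (s − t_{k−1})(t_k − s)(t_{n−θ_n} − s)^{−α−2} ds ≥ 0. -/

import Mathlib

open Real MeasureTheory

/-- Graded mesh point `t_j = T (j/N)^r`. -/
noncomputable def gridT (T r : ℝ) (N j : ℕ) : ℝ := T * ((j : ℝ) / (N : ℝ)) ^ r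

/-- Step size `τ_j = t_j - t_{j-1}`. -/
noncomputable def gridTau (T r : ℝ) (N j : ℕ) : ℝ := gridT T r N j - gridT T r N (j - 1)

/-- Step-size ratio `ρ_j = τ_j / τ_{j+1}`. -/
noncomputable def gridRho (T r : ℝ) (N j : ℕ) : ℝ := gridTau T r N j / gridTau T r N (j + 1)

/-- Offset point `t_{n-θ} = θ t_{n-1} + (1-θ) t_n`. -/
noncomputable def tTheta (T r : ℝ) (N n : ℕ) (θ : ℝ) : ℝ :=
  θ * gridT T r N (n - 1) + (1 - θ) * gridT T r N n

/-- Coefficient `a_{n-k}^{(α)}`, parametrized by `k`. -/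
noncomputable def coefA (T r : ℝ) (N n : ℕ) (θ α : ℝ) (k : ℕ) : ℝ :=
  (1 / (gridTau T r N k * Real.Gamma (1 - α))) *
    ∫ s in (gridT T r N (k - 1))..(min (gridT T r N k) (tTheta T r N n θ)),
      (tTheta T r N n θ - s) ^ (-α)

/-- Coefficient `b_{n-k}^{(α)}`, parametrized by `k`. -/
noncomputable def coefB (T r : ℝ) (N n : ℕ) (θ α : ℝ) (k : ℕ) : ℝ :=
  (2 / (gridTau T r N k * (gridTau T r N k + gridTau T r N (k + 1)) * Real.Gamma (1 - α))) *
    ∫ s in (gridT T r N (k - 1))..(gridT T r N k),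
      (s - (gridT T r N (k - 1) + gridT T r N k) / 2) * (tTheta T r N n θ - s) ^ (-α)

/-- Coefficient `I_{n-k}^{(α)}`, parametrized by `k`. -/
noncomputable def coefI (T r : ℝ) (N n : ℕ) (θ α : ℝ) (k : ℕ) : ℝ :=
  (α / (Real.Gamma (1 - α) * gridTau T r N k)) *
    ∫ s in (gridT T r N (k - 1))..(gridT T r N k),
      (gridT T r N k - s) * (tTheta T r N n θ - s) ^ (-α - 1)

/-- Coefficient `J_{n-k}^{(α)}`, parametrized by `k`. -/
noncomputable def coefJ (T r : ℝ) (N n : ℕ) (θ α : ℝ) (k : ℕ) : ℝ :=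
  (α / (Real.Gamma (1 - α) * gridTau T r N k)) *
    ∫ s in (gridT T r N (k - 1))..(gridT T r N k),
      (s - gridT T r N (k - 1)) * (tTheta T r N n θ - s) ^ (-α - 1)

/-- Coefficient `c_{n-k,n}^{(α)}`, parametrized by `k` (`1 ≤ k ≤ n`). -/
noncomputable def coefC (T r : ℝ) (N n : ℕ) (θ α : ℝ) (k : ℕ) : ℝ :=
  if n = 1 then coefA T r N n θ α n
  else if k = n then coefA T r N n θ α n + gridRho T r N (n - 1) * coefB T r N n θ α (n - 1)
  else if k = 1 then coefA T r N n θ α 1 - coefB T r N n θ α 1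
  else coefA T r N n θ α k + gridRho T r N (k - 1) * coefB T r N n θ α (k - 1)
         - coefB T r N n θ α k

/-- Integration by parts for `(s - a) (b - s) (x - s) ^ p`, which vanishes at both endpoints. -/
theorem integral_sub_left_mul_rpow_sub_integral_sub_right_mul_rpow {a b x : ℝ} (p : ℝ)
    (hab : a ≤ b) (hbx : b < x) :
    (∫ s in a..b, (s - a) * (x - s) ^ p) - ∫ s in a..b, (b - s) * (x - s) ^ p =
      -p * ∫ s in a..b, (s - a) * (b - s) * (x - s) ^ (p - 1) := by
  have hpos : ∀ s ∈ Set.uIcc a b, 0 < x - s := fun s hs ↦ by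
    rw [Set.uIcc_of_le hab] at hs
    linarith [hs.2]
  have hcont : ∀ q : ℝ, ContinuousOn (fun s : ℝ ↦ (x - s) ^ q) (Set.uIcc a b) := fun q ↦
    ContinuousOn.rpow_const (by fun_prop) fun s hs ↦ Or.inl (hpos s hs).ne'
  have hleft : IntervalIntegrable (fun s ↦ (s - a) * (x - s) ^ p) volume a b :=
    (ContinuousOn.mul (by fun_prop) (hcont p)).intervalIntegrable
  have hright : IntervalIntegrable (fun s ↦ (b - s) * (x - s) ^ p) volume a b :=
    (ContinuousOn.mul (by fun_prop) (hcont p)).intervalIntegrable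
  have hprod : IntervalIntegrable (fun s ↦ p * ((s - a) * (b - s) * (x - s) ^ (p - 1)))
      volume a b :=
    (continuousOn_const.mul
      (ContinuousOn.mul (by fun_prop) (hcont (p - 1)))).intervalIntegrable
  have hderiv : ∀ s ∈ Set.uIcc a b, HasDerivAt (fun s ↦ (s - a) * (b - s) * (x - s) ^ p)
      ((b - s) * (x - s) ^ p - (s - a) * (x - s) ^ p
        - p * ((s - a) * (b - s) * (x - s) ^ (p - 1))) s := fun s hs ↦ by
    have h := (((hasDerivAt_id s).sub_const a).mul ((hasDerivAt_id s).const_sub b)).mul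
      (((hasDerivAt_id s).const_sub x).rpow_const (p := p) (Or.inl (hpos s hs).ne'))
    refine h.congr_deriv ?_
    simp only [Pi.mul_apply, id]
    ring
  have hftc := intervalIntegral.integral_eq_sub_of_hasDerivAt hderiv
    ((hright.sub hleft).sub hprod)
  rw [intervalIntegral.integral_sub (hright.sub hleft) hprod,
    intervalIntegral.integral_sub hright hleft, intervalIntegral.integral_const_mul] at hftc
  simp only [sub_self, mul_zero, zero_mul] at hftc
  linarith

theorem gridT_strictMono {T r : ℝ} {N : ℕ} (hT : 0 < T) (hr : 0 < r) (hN : 0 < N) :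
    StrictMono (gridT T r N) := fun i j hij ↦ by
  have hN' : (0 : ℝ) < N := by exact_mod_cast hN
  have hij' : (i : ℝ) < j := by exact_mod_cast hij
  unfold gridT
  gcongr

theorem gridT_lt_tTheta {T r θ : ℝ} {N n : ℕ} (hT : 0 < T) (hr : 0 < r) (hN : 0 < N)
    (hn : 0 < n) (hθ : θ < 1) : gridT T r N (n - 1) < tTheta T r N n θ := by
  have h := gridT_strictMono hT hr hN (Nat.sub_lt hn one_pos)
  unfold tTheta
  nlinarith

/-- For `2 ≤ n ≤ N`, `θ ∈ [0,1/2]`, `α ∈ (0,1)` and `1 ≤ k ≤ n-1`, one has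
`J_{n-k}^{(α)} - I_{n-k}^{(α)} = (α(1+α)/(Γ(1-α)τ_k)) ∫ (s-t_{k-1})(t_k-s)(t_{n-θ}-s)^{-α-2} ds ≥ 0`,
hence `J_{n-k}^{(α)} ≥ I_{n-k}^{(α)}`. -/
theorem coefJ_ge_coefI (T r : ℝ) (N n : ℕ) (θ α : ℝ)
    (hT : 0 < T) (hr : 1 ≤ r) (hN : 1 ≤ N) (hn2 : 2 ≤ n) (hnN : n ≤ N)
    (hθ0 : 0 ≤ θ) (hθ : θ ≤ 1 / 2) (hα0 : 0 < α) (hα1 : α < 1) :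
    ∀ k : ℕ, 1 ≤ k → k ≤ n - 1 →
      coefJ T r N n θ α k - coefI T r N n θ α k =
        (α * (1 + α) / (Real.Gamma (1 - α) * gridTau T r N k)) *
          ∫ s in (gridT T r N (k - 1))..(gridT T r N k),
            (s - gridT T r N (k - 1)) * (gridT T r N k - s) *
              (tTheta T r N n θ - s) ^ (-α - 2) ∧
      coefI T r N n θ α k ≤ coefJ T r N n θ α k := by
  intro k hk1 hkn
  have hr0 : 0 < r := by linarith
  have hmono := gridT_strictMono hT hr0 hN
  have hab : gridT T r N (k - 1) < gridT T r N k := hmono (by omega)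
  have hbx : gridT T r N k < tTheta T r N n θ :=
    (hmono.monotone hkn).trans_lt (gridT_lt_tTheta hT hr0 hN (by omega) (by linarith))
  have hΓ : 0 < Real.Gamma (1 - α) := Real.Gamma_pos_of_pos (by linarith)
  have hτ : 0 < gridTau T r N k := sub_pos.2 hab
  have hdiff : coefJ T r N n θ α k - coefI T r N n θ α k =
      (α * (1 + α) / (Real.Gamma (1 - α) * gridTau T r N k)) *
        ∫ s in (gridT T r N (k - 1))..(gridT T r N k),
          (s - gridT T r N (k - 1)) * (gridT T r N k - s) *
            (tTheta T r N n θ - s) ^ (-α - 2) := by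
    unfold coefJ coefI
    rw [← mul_sub, integral_sub_left_mul_rpow_sub_integral_sub_right_mul_rpow _ hab.le hbx,
      show -α - 1 - 1 = -α - 2 by ring]
    ring
  refine ⟨hdiff, sub_nonneg.1 ?_⟩
  rw [hdiff]
  refine mul_nonneg (by positivity) (intervalIntegral.integral_nonneg hab.le fun s hs ↦ ?_)
  exact mul_nonneg (mul_nonneg (sub_nonneg.2 hs.1) (sub_nonneg.2 hs.2))
    (Real.rpow_nonneg (by linarith [hs.2]) _)
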